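/- Every componentwise polymatroidal ideal with the strong exchange property has linear quotients. -/

import Mathlib

/-- A monomial in `K[x_1,...,x_n]` is identified with its exponent vector. -/
abbrev Mon (n : ℕ) := Fin n → ℕ

/-- Total degree of a monomial. -/
def degree {n : ℕ} (u : Mon n) : ℕ := ∑ i, u i

/-- A monomial ideal is identified with the set of exponent vectors of the monomials it
contains; this set is closed under multiplication by monomials. -/
def IsMonomialIdeal {n : ℕ} (I : Set (Mon n)) : Prop :=
  ∀ u ∈ I, ∀ w : Mon n, u + w ∈ I

/-- The minimal monomial generating set `G(I)` of a monomial ideal: monomials of `I`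
minimal with respect to divisibility (pointwise `≤` of exponent vectors). -/
def minGens {n : ℕ} (I : Set (Mon n)) : Set (Mon n) :=
  {u | u ∈ I ∧ ∀ v ∈ I, v ≤ u → v = u}

/-- `exch v i j` is the exponent vector of `x_j * (v / x_i)` (for `i ≠ j`). -/
def exch {n : ℕ} (v : Mon n) (i j : Fin n) : Mon n :=
  fun k => if k = i then v k - 1 else if k = j then v k + 1 else v k

/-- `component I d` is the ideal `I_⟨d⟩` generated by the degree-`d` monomials of `I`. -/
def component {n : ℕ} (I : Set (Mon n)) (d : ℕ) : Set (Mon n) :=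
  {w | ∃ u ∈ I, degree u = d ∧ u ≤ w}

/-- `I` is generated in a single degree. -/
def GeneratedInSingleDegree {n : ℕ} (I : Set (Mon n)) : Prop :=
  ∃ d, ∀ u ∈ minGens I, degree u = d

/-- A polymatroidal ideal: generated in a single degree and its generators satisfy the
exchange property. -/
def IsPolymatroidal {n : ℕ} (I : Set (Mon n)) : Prop :=
  GeneratedInSingleDegree I ∧
  ∀ u ∈ minGens I, ∀ v ∈ minGens I, ∀ i : Fin n, v i < u i →
    ∃ j : Fin n, u j < v j ∧ exch u i j ∈ I

/-- Componentwise polymatroidal: each graded component ideal `I_⟨d⟩` is polymatroidal. -/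
def ComponentwisePolymatroidal {n : ℕ} (I : Set (Mon n)) : Prop :=
  ∀ d : ℕ, IsPolymatroidal (component I d)

/-- Non-pure dual exchange property: for `u, v ∈ G(I)` with `deg u ≤ deg v` and
`deg_{x_i} v < deg_{x_i} u` there is `j` with `deg_{x_j} v > deg_{x_j} u` and
`x_i * (v / x_j) ∈ I`. -/
def NonPureDualExchange {n : ℕ} (I : Set (Mon n)) : Prop :=
  ∀ u ∈ minGens I, ∀ v ∈ minGens I, degree u ≤ degree v →
    ∀ i : Fin n, v i < u i → ∃ j : Fin n, u j < v j ∧ exch v j i ∈ I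

/-- Non-pure exchange property: for `u, v ∈ G(I)` with `deg u ≤ deg v` and
`deg_{x_i} v > deg_{x_i} u` there is `j` with `deg_{x_j} v < deg_{x_j} u` and
`x_j * (v / x_i) ∈ I`. -/
def NonPureExchange {n : ℕ} (I : Set (Mon n)) : Prop :=
  ∀ u ∈ minGens I, ∀ v ∈ minGens I, degree u ≤ degree v →
    ∀ i : Fin n, u i < v i → ∃ j : Fin n, v j < u j ∧ exch v i j ∈ I

/-- The monomial ideal generated by a set `G` of monomials. -/
def genBy {n : ℕ} (G : Set (Mon n)) : Set (Mon n) := {w | ∃ u ∈ G, u ≤ w}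

/-- The product of two monomial ideals (as sets of monomials). -/
def mulIdeal {n : ℕ} (I J : Set (Mon n)) : Set (Mon n) :=
  {w | ∃ u ∈ I, ∃ v ∈ J, w = u + v}

/-- The product of a monomial ideal with the monomial `u`. -/
def mulMon {n : ℕ} (u : Mon n) (I : Set (Mon n)) : Set (Mon n) :=
  (fun v => u + v) '' I

/-- Strong exchange property: for all generators `u, v` and all `i, j` with
`deg_{x_i} u > deg_{x_i} v` and `deg_{x_j} u < deg_{x_j} v`, `x_j * (u / x_i) ∈ I`. -/
def StrongExchange {n : ℕ} (I : Set (Mon n)) : Prop :=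
  ∀ u ∈ minGens I, ∀ v ∈ minGens I, ∀ i j : Fin n,
    v i < u i → u j < v j → exch u i j ∈ I

/-- The Veronese type ideal `I_{(d; a_1,...,a_n)}`: generated by all monomials of
degree `d` with `deg_{x_i} ≤ a i` for all `i`. -/
def veronese (n d : ℕ) (a : Fin n → ℕ) : Set (Mon n) :=
  {w | ∃ u : Mon n, degree u = d ∧ (∀ i, u i ≤ a i) ∧ u ≤ w}

/-- A list of monomials is an admissible order if each colon ideal
`(u_1,...,u_{i-1}) : u_i` is generated by a subset `S` of the variables. -/
def AdmissibleOrder {n : ℕ} (L : List (Mon n)) : Prop :=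
  ∀ i : Fin L.length, ∃ S : Set (Fin n),
    ∀ w : Mon n, (w + L.get i ∈ genBy {u | u ∈ L.take i.1}) ↔ ∃ k ∈ S, 1 ≤ w k

/-- `I` has linear quotients: some ordering of `G(I)` is admissible. -/
def HasLinearQuotients {n : ℕ} (I : Set (Mon n)) : Prop :=
  ∃ L : List (Mon n), L.Nodup ∧ (∀ u, u ∈ L ↔ u ∈ minGens I) ∧ AdmissibleOrder L

/-- `I` can be extended by linear quotients to `J`: `G(I) ⊆ G(J)` and the elements of
`G(J) \ G(I)` can be ordered `v_1,...,v_m` such that each colon ideal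
`(G(I), v_1,...,v_i) : v_{i+1}` is generated by a subset of the variables. -/
def ExtendsByLinearQuotients {n : ℕ} (I J : Set (Mon n)) : Prop :=
  I ⊆ J ∧ minGens I ⊆ minGens J ∧
  ∃ L : List (Mon n), L.Nodup ∧ (∀ u, u ∈ L ↔ u ∈ minGens J ∧ u ∉ minGens I) ∧
    ∀ i : Fin L.length, ∃ S : Set (Fin n),
      ∀ w : Mon n,
        (w + L.get i ∈ genBy (minGens I ∪ {u | u ∈ L.take i.1})) ↔ ∃ k ∈ S, 1 ≤ w k

/-- The minimal generators of `I ⊆ K[x,y]` are `u_i = x^{a i} y^{b i}`, `i = 0,...,m`,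
with `a` strictly decreasing, `b` strictly increasing, `a m = 0` and `b 0 = 0`
(so `I` is `(x,y)`-primary). -/
def yxTightGens (m : ℕ) (a b : ℕ → ℕ) (I : Set (Mon 2)) : Prop :=
  (∀ i k : ℕ, i ≤ m → k ≤ m → i < k → a k < a i ∧ b i < b k) ∧
  a m = 0 ∧ b 0 = 0 ∧
  minGens I = {u | ∃ i ≤ m, u = ![a i, b i]}

/-- `I` is `x`-tight in `[0, r]`: the `x`-exponents of the generators are exactly
`r, r-1, ..., 1, 0` (i.e. `a (r - i) = i`). -/
def xTight (I : Set (Mon 2)) (r : ℕ) : Prop :=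
  ∃ b : ℕ → ℕ, yxTightGens r (fun i => r - i) b I

/-- `I` is `y`-tight in `[0, s]`: the `y`-exponents of the generators are exactly
`0, 1, ..., s`. -/
def yTight (I : Set (Mon 2)) (s : ℕ) : Prop :=
  ∃ a : ℕ → ℕ, yxTightGens s a (fun i => i) I

/-- `I` is `yx`-tight: there is `0 ≤ j ≤ m` with `b i = i` for `i = 0,...,j` and
`a (m - i) = i` for `i = 0,...,m-j`. -/
def yxTight (I : Set (Mon 2)) : Prop :=
  ∃ (m : ℕ) (a b : ℕ → ℕ), yxTightGens m a b I ∧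
    ∃ j ≤ m, (∀ i ≤ j, b i = i) ∧ ∀ i ≤ m - j, a (m - i) = i

/-- Powers of a monomial ideal. -/
def powIdeal {n : ℕ} (I : Set (Mon n)) : ℕ → Set (Mon n)
  | 0 => Set.univ
  | k + 1 => mulIdeal (powIdeal I k) I

theorem degree_mono {n : ℕ} {u v : Mon n} (h : u ≤ v) : degree u ≤ degree v :=
  Finset.sum_le_sum fun i _ => h i

theorem eq_of_le_of_degree_le {n : ℕ} {u v : Mon n} (h : u ≤ v) (hd : degree v ≤ degree u) :
    u = v := by
  funext i
  exact (Finset.sum_eq_sum_iff_of_le fun i _ => h i).1 (le_antisymm (degree_mono h) hd) i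
    (Finset.mem_univ i)

theorem exists_lt_of_degree_lt {n : ℕ} {u v : Mon n} (h : degree u < degree v) :
    ∃ j, u j < v j := by
  by_contra! hc
  exact absurd (degree_mono (u := v) (v := u) hc) (not_le.2 h)

theorem exists_lt_of_degree_le {n : ℕ} {u v : Mon n} (h : degree u ≤ degree v) {i : Fin n}
    (hi : v i < u i) : ∃ j, u j < v j := by
  by_contra! hc
  have := eq_of_le_of_degree_le (u := v) (v := u) hc h
  simp [this] at hi

/-- A separable sum changes only in the two exchanged coordinates. -/
theorem sum_exch {n : ℕ} (φ : Fin n → ℕ → ℤ) (v : Mon n) {j k : Fin n} (hjk : j ≠ k) :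
    ∑ i, φ i (exch v j k i) = ∑ i, φ i (v i) + (φ k (v k + 1) - φ k (v k)) +
      (φ j (v j - 1) - φ j (v j)) := by
  have key : ∀ i, φ i (exch v j k i) = φ i (v i) +
      (if i = k then φ k (v k + 1) - φ k (v k) else 0) +
      (if i = j then φ j (v j - 1) - φ j (v j) else 0) := by
    intro i
    unfold exch
    by_cases h1 : i = j
    · subst h1
      simp [hjk]
    · by_cases h2 : i = k
      · subst h2
        simp [h1]
      · simp [h1, h2]
  simp [key, Finset.sum_add_distrib]

theorem degree_exch {n : ℕ} {v : Mon n} {j k : Fin n} (hjk : j ≠ k) (hj : 0 < v j) :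
    degree (exch v j k) = degree v := by
  have := sum_exch (fun _ t => (t : ℤ)) v hjk
  unfold degree
  zify
  rw [this]
  push_cast [Nat.cast_sub (Nat.succ_le_of_lt hj)]
  ring

theorem exch_self_left {n : ℕ} (v : Mon n) (j k : Fin n) : exch v j k j = v j - 1 := by
  simp [exch]

theorem exch_self_right {n : ℕ} (v : Mon n) {j k : Fin n} (h : j ≠ k) :
    exch v j k k = v k + 1 := by
  simp [exch, h.symm]

theorem exch_of_ne {n : ℕ} (v : Mon n) {j k i : Fin n} (hj : i ≠ j) (hk : i ≠ k) :
    exch v j k i = v i := by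
  simp [exch, hj, hk]

/-- The monomials of degree `d` in `I`. -/
def homogeneousPart {n : ℕ} (I : Set (Mon n)) (d : ℕ) : Set (Mon n) :=
  {u | u ∈ I ∧ degree u = d}

theorem mem_minGens_component {n : ℕ} {I : Set (Mon n)} {d : ℕ} {u : Mon n}
    (hu : u ∈ homogeneousPart I d) : u ∈ minGens (component I d) := by
  refine ⟨⟨u, hu.1, hu.2, le_rfl⟩, ?_⟩
  rintro v ⟨w, -, hwd, hwv⟩ hvu
  have := eq_of_le_of_degree_le (hwv.trans hvu) (by rw [hwd, hu.2])
  exact le_antisymm hvu (this ▸ hwv)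

/-- Sets of monomials of degree `d` in which all possible exchanges can be performed. -/
def IsStrongExchangeSet {n : ℕ} (B : Set (Mon n)) (d : ℕ) : Prop :=
  (∀ u ∈ B, degree u = d) ∧
    ∀ u ∈ B, ∀ v ∈ B, ∀ i j : Fin n, v i < u i → u j < v j → exch u i j ∈ B

theorem isStrongExchangeSet_homogeneousPart {n : ℕ} {I : Set (Mon n)} {d : ℕ}
    (h : StrongExchange (component I d)) : IsStrongExchangeSet (homogeneousPart I d) d := by
  refine ⟨fun u hu => hu.2, fun u hu v hv i j hi hj => ?_⟩
  obtain ⟨w, hw, hwd, hle⟩ :=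
    h u (mem_minGens_component hu) v (mem_minGens_component hv) i j hi hj
  have hij : i ≠ j := by
    rintro rfl
    omega
  have hd : degree (exch u i j) = d := by rw [degree_exch hij (by omega), hu.2]
  have := eq_of_le_of_degree_le hle (by rw [hd, hwd])
  exact ⟨this ▸ hw, hd⟩

theorem IsStrongExchangeSet.exch_mem {n : ℕ} {B : Set (Mon n)} {d : ℕ}
    (hB : IsStrongExchangeSet B d) {u w w' : Mon n} (hu : u ∈ B) (hw : w ∈ B) (hw' : w' ∈ B)
    {k j : Fin n} (hkj : k ≠ j) (hk : w k < u k) (hj : u j < w' j) : exch u k j ∈ B := by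
  by_cases h1 : u j < w j
  · exact hB.2 u hu w hw k j hk h1
  by_cases h2 : w' k < u k
  · exact hB.2 u hu w' hw' k j h2 hj
  obtain ⟨i, hi⟩ := exists_lt_of_degree_le (u := u) (v := w) (by rw [hB.1 u hu, hB.1 w hw]) hk
  obtain ⟨m, hm⟩ :=
    exists_lt_of_degree_le (u := w') (v := u) (by rw [hB.1 u hu, hB.1 w' hw']) hj
  have hki : k ≠ i := by rintro rfl; omega
  have hij : i ≠ j := by rintro rfl; omega
  have hmj : m ≠ j := by rintro rfl; omega
  have hu1 := hB.2 u hu w hw k i hk hi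
  have hu2 := hB.2 u hu w' hw' m j hm hj
  have hlt : exch u m j i < exch u k i i := by
    rw [exch_self_right u hki]
    unfold exch
    split_ifs <;> omega
  have hgt : exch u k i j < exch u m j j := by
    rw [exch_self_right u hmj, exch_of_ne u hkj.symm hij.symm]
    omega
  have := hB.2 _ hu1 _ hu2 i j hlt hgt
  convert this using 1
  funext t
  unfold exch
  split_ifs <;> simp_all

/-- A strong exchange set is cut out by a box. -/
theorem IsStrongExchangeSet.exists_box {n : ℕ} {B : Set (Mon n)} {d : ℕ}
    (hB : IsStrongExchangeSet B d) : ∃ l a : Mon n, ∀ u ∈ B, l ≤ u ∧ u ≤ a ∧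
      ∀ k j : Fin n, k ≠ j → l k < u k → u j < a j → exch u k j ∈ B := by
  rcases B.eq_empty_or_nonempty with rfl | hne
  · exact ⟨0, 0, fun u hu => absurd hu (Set.notMem_empty u)⟩
  have hne' : ∀ i, ((fun u : Mon n => u i) '' B).Nonempty := fun i => hne.image _
  have hbdd : ∀ i, BddAbove ((fun u : Mon n => u i) '' B) := by
    rintro i
    refine ⟨d, ?_⟩
    rintro _ ⟨u, hu, rfl⟩
    rw [← hB.1 u hu]
    exact Finset.single_le_sum (f := u) (fun _ _ => Nat.zero_le _) (Finset.mem_univ i)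
  refine ⟨fun i => sInf ((fun u : Mon n => u i) '' B), fun i => sSup ((fun u : Mon n => u i) '' B),
    fun u hu => ⟨fun i => Nat.sInf_le ⟨u, hu, rfl⟩, fun i => le_csSup (hbdd i) ⟨u, hu, rfl⟩, ?_⟩⟩
  intro k j hkj hk hj
  obtain ⟨w, hw, hwk⟩ := Nat.sInf_mem (hne' k)
  obtain ⟨w', hw', hwj⟩ := Nat.sSup_mem (hne' j) (hbdd j)
  exact hB.exch_mem hu hw hw' hkj (hwk.trans_lt hk) (hj.trans_eq hwj.symm)

/-- The distance from `t` to the interval `[l, a]`. -/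
def intervalDist (l a t : ℕ) : ℤ := ((l - t : ℕ) : ℤ) + ((t - a : ℕ) : ℤ)

theorem intervalDist_add_le (l a t s : ℕ) :
    (intervalDist l a (t + 1) - intervalDist l a t) * s ≤
      intervalDist l a (t + s) - intervalDist l a t := by
  induction s with
  | zero => simp
  | succ s ih =>
    have : intervalDist l a (t + 1) - intervalDist l a t ≤
        intervalDist l a (t + (s + 1)) - intervalDist l a (t + s) := by
      unfold intervalDist
      omega
    push_cast
    linarith

theorem intervalDist_sub_le (l a t s : ℕ) (h : s ≤ t) :
    (intervalDist l a (t - 1) - intervalDist l a t) * s ≤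
      intervalDist l a (t - s) - intervalDist l a t := by
  induction s with
  | zero => simp
  | succ s ih =>
    have : intervalDist l a (t - 1) - intervalDist l a t ≤
        intervalDist l a (t - (s + 1)) - intervalDist l a (t - s) := by
      unfold intervalDist
      omega
    have := ih (by omega)
    push_cast
    linarith

/-- The `ℓ¹`-distance from `v` to the box `[l, a]`. -/
def boxDist {n : ℕ} (l a v : Mon n) : ℤ := ∑ i, intervalDist (l i) (a i) (v i)

/-- If the box distance grows by less than `c ≥ 0` from `v` to `u`, then some exchange moving `v`
towards `u` makes it grow by less than `c`, and by less than `0` unless it lowers the prescribed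
coordinate `j₀`. -/
theorem exists_boxDist_exch_sub_lt {n : ℕ} (l a : Mon n) {u v : Mon n}
    (hd : degree u = degree v) {c : ℤ} (hc0 : 0 ≤ c) (hf : boxDist l a u - boxDist l a v < c)
    {j₀ : Fin n} (hj₀ : u j₀ < v j₀) :
    ∃ k j, v k < u k ∧ u j < v j ∧
      boxDist l a (exch v j k) - boxDist l a v < if j = j₀ then c else 0 := by
  by_contra! hc
  obtain ⟨k₀, hk₀⟩ := exists_lt_of_degree_le hd.ge hj₀
  set α : Fin n → ℤ := fun k =>
    intervalDist (l k) (a k) (v k + 1) - intervalDist (l k) (a k) (v k) with hα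
  set β : Fin n → ℤ := fun k =>
    intervalDist (l k) (a k) (v k - 1) - intervalDist (l k) (a k) (v k) with hβ
  obtain ⟨k, hk, hmin⟩ := Finset.exists_min_image
    (Finset.univ.filter fun k => v k < u k) α ⟨k₀, by simpa using hk₀⟩
  simp only [Finset.mem_filter, Finset.mem_univ, true_and] at hk hmin
  have hdist : ∀ j, u j < v j → boxDist l a (exch v j k) = boxDist l a v + α k + β j := by
    intro j hj
    exact sum_exch (fun i t => intervalDist (l i) (a i) t) v (by rintro rfl; omega)
  have hβ' : ∀ j, u j < v j → (if j = j₀ then c else 0) - α k ≤ β j := by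
    intro j hj
    have := hc k j hk hj
    rw [hdist j hj] at this
    linarith
  have hterm : ∀ i, α k * ((u i : ℤ) - v i) + (if i = j₀ then c else 0) ≤
      intervalDist (l i) (a i) (u i) - intervalDist (l i) (a i) (v i) := by
    intro i
    rcases le_or_gt (v i) (u i) with h | h
    · have hne : i ≠ j₀ := by rintro rfl; omega
      obtain ⟨s, hs⟩ := Nat.exists_eq_add_of_le h
      have h1 := intervalDist_add_le (l i) (a i) (v i) s
      rw [hs]
      rcases Nat.eq_zero_or_pos s with rfl | hpos
      · simp [hne]
      · have h2 := mul_le_mul_of_nonneg_right (hmin i (by omega)) (Int.natCast_nonneg s)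
        simp only [hne, if_false]
        push_cast
        linarith
    · obtain ⟨s, hs⟩ := Nat.exists_eq_add_of_le h.le
      have h1 := intervalDist_sub_le (l i) (a i) (v i) s (by omega)
      have hs' : v i - s = u i := by omega
      have hsz : (u i : ℤ) - v i = -s := by omega
      have hs1 : (1 : ℤ) ≤ s := by omega
      rw [hs'] at h1
      rw [hsz]
      change β i * s ≤ _ at h1
      have h2 := hβ' i h
      split_ifs at h2 ⊢ <;> nlinarith
  have hsum := Finset.sum_le_sum fun i (_ : i ∈ Finset.univ) => hterm i
  have hdz : ∑ i, (u i : ℤ) = ∑ i, (v i : ℤ) := by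
    exact_mod_cast hd
  rw [Finset.sum_add_distrib, ← Finset.mul_sum, Finset.sum_sub_distrib,
    Finset.sum_sub_distrib, hdz] at hsum
  simp only [sub_self, mul_zero, zero_add, Finset.sum_ite_eq', Finset.mem_univ, if_true] at hsum
  unfold boxDist at hf
  linarith

theorem boxDist_exch_lt {n : ℕ} {l a u v : Mon n} (hl : l ≤ u) (ha : u ≤ a) {j k : Fin n}
    (hk : v k < u k) (hj : u j < v j) (h : ¬ (l k < u k ∧ u j < a j)) :
    boxDist l a (exch v j k) < boxDist l a v := by
  have hsum := sum_exch (fun i t => intervalDist (l i) (a i) t) v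
    (show j ≠ k by rintro rfl; omega)
  have h1 : l k ≤ u k := hl k
  have h2 : l j ≤ u j := hl j
  have h3 : u k ≤ a k := ha k
  have h4 : u j ≤ a j := ha j
  unfold boxDist
  rw [hsum]
  unfold intervalDist
  omega

theorem exists_between_degree {n : ℕ} {u m : Mon n} (hum : u ≤ m) {d : ℕ} (hu : degree u ≤ d)
    (hm : d ≤ degree m) : ∃ w, u ≤ w ∧ w ≤ m ∧ degree w = d := by
  induction d, hu using Nat.le_induction with
  | base => exact ⟨u, le_rfl, hum, rfl⟩
  | succ d _ ih =>
    obtain ⟨w, huw, hwm, hwd⟩ := ih (by omega)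
    obtain ⟨j, hj⟩ := exists_lt_of_degree_lt (u := w) (v := m) (by omega)
    refine ⟨w + Pi.single j 1, huw.trans le_self_add, fun i => ?_, ?_⟩
    · by_cases h : i = j
      · subst h
        simpa using hj
      · simpa [h] using hwm i
    · simp [degree, Finset.sum_add_distrib, ← hwd]

theorem exists_minGens_le {n : ℕ} {I : Set (Mon n)} {u : Mon n} (hu : u ∈ I) :
    ∃ g ∈ minGens I, g ≤ u := by
  obtain ⟨g, hgu, hg⟩ := exists_minimal_le_of_wellFoundedLT (· ∈ I) u hu
  exact ⟨g, ⟨hg.1, fun v hv hvg => le_antisymm hvg (hg.2 hv hvg)⟩, hgu⟩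

theorem finite_minGens {n : ℕ} (I : Set (Mon n)) : (minGens I).Finite := by
  refine WellQuasiOrderedLE.finite_of_isAntichain ?_
  intro u hu v hv hne hle
  exact hne (hv.2 u hu.1 hle)

theorem exch_le_add_single {n : ℕ} (v : Mon n) {j k : Fin n} :
    exch v j k ≤ v + Pi.single k 1 := by
  intro i
  unfold exch
  by_cases h : i = k
  · subst h
    simp
    split_ifs <;> omega
  · simp only [h, if_false, Pi.add_apply, Pi.single_apply]
    split_ifs <;> omega

/-- Sorting the generators by an injective key reduces linear quotients to an exchange-type
condition. -/
theorem hasLinearQuotients_of_key {n : ℕ} {I : Set (Mon n)} {α : Type*} [LinearOrder α]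
    (key : Mon n → α) (hkey : Function.Injective key)
    (h : ∀ u ∈ minGens I, ∀ v ∈ minGens I, key u < key v →
      ∃ k, v k < u k ∧ ∃ g ∈ minGens I, key g < key v ∧ g ≤ v + Pi.single k 1) :
    HasLinearQuotients I := by
  let _ : LinearOrder (Mon n) := LinearOrder.lift' key hkey
  let L : List (Mon n) := (finite_minGens I).toFinset.sort (fun u v => key u ≤ key v)
  have hmem : ∀ u, u ∈ L ↔ u ∈ minGens I := by
    intro u
    simp [L]
  have hnodup : L.Nodup := Finset.sort_nodup _ _
  have hsorted : L.Pairwise (fun u v => key u ≤ key v) := Finset.pairwise_sort _ _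
  have htake : ∀ (i : Fin L.length) (u : Mon n),
      u ∈ L.take i.1 ↔ u ∈ minGens I ∧ key u < key (L.get i) := by
    intro i u
    rw [List.mem_take_iff_getElem, ← hmem]
    constructor
    · rintro ⟨m, hm, rfl⟩
      have hmi : m < i.1 := by omega
      refine ⟨List.getElem_mem _, lt_of_le_of_ne ?_ ?_⟩
      · exact List.pairwise_iff_getElem.1 hsorted m i.1 (by omega) i.2 hmi
      · intro he
        have := (hnodup.getElem_inj_iff (hi := by omega) (hj := i.2)).1 (hkey he)
        omega
    · rintro ⟨hu, hlt⟩
      obtain ⟨m, hm, rfl⟩ := List.getElem_of_mem hu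
      refine ⟨m, ?_, rfl⟩
      by_contra hcon
      rcases (show i.1 = m ∨ i.1 < m by omega) with he | hl
      · subst he
        exact lt_irrefl _ hlt
      · exact absurd (List.pairwise_iff_getElem.1 hsorted i.1 m i.2 hm hl) (not_le.2 hlt)
  refine ⟨L, hnodup, hmem, fun i => ?_⟩
  have hv : L.get i ∈ minGens I := (hmem _).1 (List.get_mem L i)
  refine ⟨{k | ∃ g ∈ L.take i.1, g ≤ L.get i + Pi.single k 1}, fun w => ⟨?_, ?_⟩⟩
  · rintro ⟨u, hu, huw⟩
    obtain ⟨hu, hlt⟩ := (htake i u).1 hu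
    obtain ⟨k, hk, g, hg, hgk, hgle⟩ := h u hu _ hv hlt
    refine ⟨k, ⟨g, (htake i g).2 ⟨hg, hgk⟩, hgle⟩, ?_⟩
    have : u k ≤ w k + L.get i k := huw k
    omega
  · rintro ⟨k, ⟨g, hg, hgle⟩, hk⟩
    refine ⟨g, hg, hgle.trans ?_⟩
    rw [add_comm w]
    refine add_le_add le_rfl fun m => ?_
    by_cases hm : m = k
    · subst hm
      simpa using hk
    · simp [hm]

/-- If `v` has larger degree than an element of a strong exchange set `B` bounded by the box
`[l, a]`, then a step from `v` towards this element leads to a multiple of an element of `B` or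
is the first half of an exchange which brings `v` closer to the box. -/
theorem exists_step_of_degree_lt {n : ℕ} {B : Set (Mon n)} {l a v : Mon n}
    (hB : ∀ u ∈ B, l ≤ u ∧ u ≤ a ∧
      ∀ k j : Fin n, k ≠ j → l k < u k → u j < a j → exch u k j ∈ B)
    (s : ℕ) {u : Mon n} (hu : u ∈ B) (hdeg : degree u < degree v) (huv : ¬ u ≤ v)
    (hs : ∑ i, (u i - v i) ≤ s) :
    ∃ k, v k < u k ∧ ((∃ w ∈ B, degree w = degree u ∧ w ≤ v + Pi.single k 1) ∨
      ∃ w ∈ B, degree w = degree u ∧ v k < w k ∧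
        ∃ j, w j < v j ∧ boxDist l a (exch v j k) < boxDist l a v) := by
  induction s generalizing u with
  | zero =>
    refine absurd (fun i => ?_) huv
    have := (Finset.sum_eq_zero_iff.1 (Nat.le_zero.1 hs)) i (Finset.mem_univ i)
    exact Nat.sub_eq_zero_iff_le.1 this
  | succ s ih =>
    obtain ⟨k, hk⟩ : ∃ k, v k < u k := by
      by_contra! hc
      exact huv hc
    obtain ⟨j, hj⟩ := exists_lt_of_degree_lt hdeg
    have hkj : k ≠ j := by rintro rfl; omega
    by_cases hbox : l k < u k ∧ u j < a j
    · have hmem := (hB u hu).2.2 k j hkj hbox.1 hbox.2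
      have hd : degree (exch u k j) = degree u := degree_exch hkj (by omega)
      have hle : ∀ i, exch u k j i ≤ max (u i) (v i) := by
        intro i
        unfold exch
        split_ifs with h1 h2
        · omega
        · subst h2
          omega
        · omega
      by_cases hle' : exch u k j ≤ v
      · refine ⟨k, hk, Or.inl ⟨u, hu, rfl, fun i => ?_⟩⟩
        have h1 : exch u k j i ≤ v i := hle' i
        simp only [Pi.add_apply, Pi.single_apply]
        unfold exch at h1
        split_ifs at * <;> omega
      · have hsum : ∑ i, (exch u k j i - v i) < ∑ i, (u i - v i) := by
          refine Finset.sum_lt_sum (fun i _ => ?_) ⟨k, Finset.mem_univ k, ?_⟩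
          · have := hle i
            omega
          · rw [exch_self_left]
            omega
        obtain ⟨k', hk', h⟩ := ih hmem (by rwa [hd]) hle' (by omega)
        rw [hd] at h
        refine ⟨k', ?_, h⟩
        have := hle k'
        omega
    · exact ⟨k, hk, Or.inr ⟨u, hu, rfl, hk, j, hj,
        boxDist_exch_lt (hB u hu).1 (hB u hu).2.1 hk hj hbox⟩⟩

/-- every componentwise polymatroidal ideal with the strong exchange
property (i.e. every graded component is polymatroidal with the strong exchange
property) has linear quotients. -/
theorem stmt_16 {n : ℕ} (I : Set (Mon n)) (hI : IsMonomialIdeal I)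
    (h : ∀ d : ℕ, IsPolymatroidal (component I d) ∧ StrongExchange (component I d)) :
    HasLinearQuotients I := by
  have hB := fun d => isStrongExchangeSet_homogeneousPart (h d).2
  choose l a hbox using fun d => (hB d).exists_box
  let dist : Mon n → ℤ := fun v => boxDist (l (degree v - 1)) (a (degree v - 1)) v
  let key : Mon n → ℕ ×ₗ ℤ ×ₗ Lex (Fin n → ℕ) := fun v =>
    toLex (degree v, toLex (dist v, toLex v))
  have hkey : Function.Injective key := fun u v huv => by
    simpa [key] using congrArg (fun p => ofLex (ofLex (ofLex p).2).2) huv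
  have key_lt : ∀ u v, key u < key v ↔ degree u < degree v ∨ degree u = degree v ∧
      (dist u < dist v ∨ dist u = dist v ∧ toLex u < toLex v) := by
    intro u v
    simp [key, Prod.Lex.toLex_lt_toLex]
  have lower : ∀ {v w : Mon n}, w ∈ I → (degree w < degree v ∨ key w < key v) →
      ∃ g ∈ minGens I, key g < key v ∧ g ≤ w := by
    intro v w hw hlt
    obtain ⟨g, hg, hgw⟩ := exists_minGens_le hw
    refine ⟨g, hg, ?_, hgw⟩
    rcases (degree_mono hgw).lt_or_eq with hd | hd
    · rw [key_lt] at hlt ⊢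
      left
      omega
    · have := eq_of_le_of_degree_le hgw hd.ge
      subst this
      rcases hlt with hlt | hlt
      · exact (key_lt _ _).2 (Or.inl hlt)
      · exact hlt
  refine hasLinearQuotients_of_key key hkey fun u hu v hv hlt => ?_
  have hvB : v ∈ homogeneousPart I (degree v) := ⟨hv.1, rfl⟩
  rcases (key_lt u v).1 hlt with hdeg | ⟨hdeg, hlt'⟩
  · have huv : ¬ u ≤ v := fun hle => by
      rw [hv.2 u hu.1 hle] at hdeg
      exact lt_irrefl _ hdeg
    obtain ⟨u', huu', hu'm, hu'd⟩ := exists_between_degree (u := u) (m := u ⊔ v)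
      (d := degree v - 1) le_sup_left (by omega)
      ((Nat.sub_le _ _).trans (degree_mono le_sup_right))
    have hu'I : u' ∈ I := by
      have := hI u hu.1 (u' - u)
      rwa [add_tsub_cancel_of_le huu'] at this
    obtain ⟨k, hk, hstep⟩ := exists_step_of_degree_lt (hbox (degree v - 1)) _
      (u := u') ⟨hu'I, hu'd⟩ (by omega) (fun hle => huv (huu'.trans hle)) le_rfl
    have hku : v k < u k := by
      have : u' k ≤ max (u k) (v k) := hu'm k
      omega
    refine ⟨k, hku, ?_⟩
    rcases hstep with ⟨w, hw, hwd, hwle⟩ | ⟨w, hw, hwd, hwk, j, hj, hd⟩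
    · obtain ⟨g, hg, hgk, hgw⟩ := lower (v := v) hw.1 (by omega)
      exact ⟨g, hg, hgk, hgw.trans hwle⟩
    · have hjk : j ≠ k := by rintro rfl; omega
      have hwB : w + Pi.single k 1 ∈ homogeneousPart I (degree v) := by
        refine ⟨hI w hw.1 _, ?_⟩
        have : degree (w + Pi.single k 1) = degree w + 1 := by
          simp [degree, Finset.sum_add_distrib]
        omega
      have hz := (hB (degree v)).2 v hvB _ hwB j k (by simpa [hjk] using hj)
        (by simp; omega)
      obtain ⟨g, hg, hgk, hgw⟩ := lower (v := v) hz.1 (Or.inr ((key_lt _ _).2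
        (Or.inr ⟨hz.2, Or.inl (by simpa only [dist, hz.2] using hd)⟩)))
      exact ⟨g, hg, hgk, hgw.trans (exch_le_add_single v)⟩
  · have huB : u ∈ homogeneousPart I (degree v) := ⟨hu.1, hdeg⟩
    have hne : u ≠ v := by
      rintro rfl
      exact lt_irrefl _ hlt
    obtain ⟨k, j, hk, hj, hz⟩ : ∃ k j, v k < u k ∧ u j < v j ∧
        (dist (exch v j k) < dist v ∨
          dist (exch v j k) = dist v ∧ toLex (exch v j k) < toLex v) := by
      have hd' : ∀ w, degree w = degree v →
          dist w = boxDist (l (degree v - 1)) (a (degree v - 1)) w := fun w hw => by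
        simp only [dist, hw]
      have hexch : ∀ {k j}, v k < u k → u j < v j → degree (exch v j k) = degree v :=
        fun {k j} hk hj => degree_exch (by rintro rfl; omega) (by omega)
      rcases hlt' with hlt' | ⟨heq, hlex⟩
      · obtain ⟨j₀, hj₀⟩ : ∃ j, u j < v j := by
          by_contra! hc
          exact hne (eq_of_le_of_degree_le (u := v) hc hdeg.le).symm
        rw [hd' u hdeg, hd' v rfl] at hlt'
        obtain ⟨k, j, hk, hj, hz⟩ :=
          exists_boxDist_exch_sub_lt _ _ hdeg le_rfl (sub_neg.2 hlt') hj₀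
        rw [← hd' _ (hexch hk hj), ← hd' v rfl, ite_self, sub_neg] at hz
        exact ⟨k, j, hk, hj, Or.inl hz⟩
      · obtain ⟨j₀, hpre, hj₀⟩ := hlex
        change ∀ i, i < j₀ → u i = v i at hpre
        change u j₀ < v j₀ at hj₀
        rw [hd' u hdeg, hd' v rfl] at heq
        obtain ⟨k, j, hk, hj, hz⟩ := exists_boxDist_exch_sub_lt _ _ hdeg zero_le_one
          (by rw [heq, sub_self]; exact zero_lt_one) hj₀
        rw [← hd' _ (hexch hk hj), ← hd' v rfl] at hz
        refine ⟨k, j, hk, hj, ?_⟩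
        split_ifs at hz with hjj
        · subst hjj
          rcases (show dist (exch v j k) ≤ dist v by omega).lt_or_eq with h1 | h1
          · exact Or.inl h1
          · refine Or.inr ⟨h1, j, fun i hi => ?_, ?_⟩
            · refine exch_of_ne v hi.ne ?_
              rintro rfl
              have := hpre i hi
              omega
            · change exch v j k j < v j
              rw [exch_self_left]
              omega
        · exact Or.inl (sub_neg.1 hz)
    have hzB := (hB (degree v)).2 v hvB u huB j k hj hk
    obtain ⟨g, hg, hgk, hgw⟩ := lower (v := v) hzB.1
      (Or.inr ((key_lt _ _).2 (Or.inr ⟨hzB.2, hz⟩)))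
    exact ⟨k, hk, g, hg, hgk, hgw.trans (exch_le_add_single v)⟩
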